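/- If the coin process X satisfies both the upper-tail condition and the lower-tail condition, and H̄(X) = H_(X) = H(X) > 0 (one-point spectrum), then for any target process Y the interval algorithm is asymptotically optimal for the average stopping time: L*_int(X,Y) = L*(X,Y) = H(Y)/H(X). -/

import Mathlib

open MeasureTheory Filter
open scoped ENNReal Classical

noncomputable section

namespace RNG

variable {𝒳 𝒴 : Type*}

/-- The length-`m` prefix of an infinite sequence, as a tuple. -/
def pre (ω : ℕ → 𝒳) (m : ℕ) : Fin m → 𝒳 := fun i => ω i

/-- The length-`m` prefix of an infinite sequence, as a list. -/
def preL (ω : ℕ → 𝒳) (m : ℕ) : List 𝒳 := (List.range m).map ω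

/-- `P_{X^m}(x^m)` : the probability of the cylinder set of a finite string `x^m`,
for a process with law `μ`. -/
def cylP [MeasurableSpace 𝒳] (μ : Measure (ℕ → 𝒳)) {m : ℕ} (x : Fin m → 𝒳) : ℝ :=
  (μ {ω | ∀ i : Fin m, ω i = x i}).toReal

/-- Validity (exact generation) of an algorithm `φ` (given as a full-tree function on finite
coin strings, `none` playing the role of `⊥`): for every target value `y`, the probability
that the algorithm terminates with output `y` equals `PY y`. -/
def Valid {B : Type*} [MeasurableSpace 𝒳] (μ : Measure (ℕ → 𝒳)) (PY : B → ℝ)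
    (φ : List 𝒳 → Option B) : Prop :=
  ∀ y : B,
    (μ {ω | ∃ i : ℕ, φ (preL ω i) = some y ∧ ∀ j < i, φ (preL ω j) = none}).toReal = PY y

/-- Strict lexicographic order on strings. -/
def lexLt [LT 𝒳] {m : ℕ} (x' x : Fin m → 𝒳) : Prop :=
  ∃ i : Fin m, (∀ j : Fin m, j < i → x' j = x j) ∧ x' i < x i

/-- The subinterval of `[0,1)` assigned to the string `x` by the interval algorithm:
strings are arranged in lexicographic order, `x` receiving an interval of length `P x`. -/
def itv [LT 𝒳] [Fintype 𝒳] {m : ℕ} (P : (Fin m → 𝒳) → ℝ) (x : Fin m → 𝒳) : Set ℝ :=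
  Set.Ico (∑ x' ∈ Finset.univ.filter (fun x' => lexLt x' x), P x')
    ((∑ x' ∈ Finset.univ.filter (fun x' => lexLt x' x), P x') + P x)

/-- The interval algorithm generating `Y^n` (target law `ν`) from the coin process `μ`
has stopped after at most `m` coin symbols on the sample `ω`, i.e. the coin interval
`I_{x^m}` is contained in some target interval `J_{y^n}`. -/
def IntStopped [LinearOrder 𝒳] [Fintype 𝒳] [LinearOrder 𝒴] [Fintype 𝒴]
    [MeasurableSpace 𝒳] [MeasurableSpace 𝒴]
    (μ : Measure (ℕ → 𝒳)) (ν : Measure (ℕ → 𝒴)) (n m : ℕ) (ω : ℕ → 𝒳) : Prop :=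
  ∃ y : Fin n → 𝒴, itv (fun x : Fin m → 𝒳 => cylP μ x) (pre ω m)
      ⊆ itv (fun y' : Fin n → 𝒴 => cylP ν y') y

/-- A rate `R` is achievable by the interval algorithm:
`Pr(T_n > nR) → 0` (the stopping time `T_n` is `ℕ`-valued, so `T_n > nR ↔ T_n > ⌊nR⌋`). -/
def IntAchievable [LinearOrder 𝒳] [Fintype 𝒳] [LinearOrder 𝒴] [Fintype 𝒴]
    [MeasurableSpace 𝒳] [MeasurableSpace 𝒴]
    (μ : Measure (ℕ → 𝒳)) (ν : Measure (ℕ → 𝒴)) (R : ℝ) : Prop :=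
  0 ≤ R ∧ Tendsto (fun n : ℕ =>
      (μ {ω | ¬ IntStopped μ ν n ⌊(n : ℝ) * R⌋₊ ω}).toReal) atTop (nhds 0)

/-- `R⋆_int(X,Y)` : the infimum rate achievable by the interval algorithm. -/
def Rint [LinearOrder 𝒳] [Fintype 𝒳] [LinearOrder 𝒴] [Fintype 𝒴]
    [MeasurableSpace 𝒳] [MeasurableSpace 𝒴]
    (μ : Measure (ℕ → 𝒳)) (ν : Measure (ℕ → 𝒴)) : ℝ :=
  sInf {R : ℝ | IntAchievable μ ν R}

/-- A rate `R` is achievable by some sequence of valid algorithms: for each `n` there is a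
valid algorithm `φ n` generating `Y^n` and `Pr(T_n > nR) → 0`. -/
def Achievable [MeasurableSpace 𝒳] [MeasurableSpace 𝒴]
    (μ : Measure (ℕ → 𝒳)) (ν : Measure (ℕ → 𝒴)) (R : ℝ) : Prop :=
  0 ≤ R ∧ ∃ φ : (n : ℕ) → List 𝒳 → Option (Fin n → 𝒴),
    (∀ n : ℕ, Valid μ (fun y : Fin n → 𝒴 => cylP ν y) (φ n)) ∧
    Tendsto (fun n : ℕ =>
      (μ {ω | ∀ i ≤ ⌊(n : ℝ) * R⌋₊, φ n (preL ω i) = none}).toReal) atTop (nhds 0)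

/-- `R⋆(X,Y)` : the infimum rate achievable over all valid algorithms. -/
def Rstar [MeasurableSpace 𝒳] [MeasurableSpace 𝒴]
    (μ : Measure (ℕ → 𝒳)) (ν : Measure (ℕ → 𝒴)) : ℝ :=
  sInf {R : ℝ | Achievable μ ν R}

/-- The expected stopping time `E[T_n]` of the interval algorithm, via `E[T] = ∑_m Pr(T>m)`. -/
def intAvgT [LinearOrder 𝒳] [Fintype 𝒳] [LinearOrder 𝒴] [Fintype 𝒴]
    [MeasurableSpace 𝒳] [MeasurableSpace 𝒴]
    (μ : Measure (ℕ → 𝒳)) (ν : Measure (ℕ → 𝒴)) (n : ℕ) : ℝ≥0∞ :=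
  ∑' m : ℕ, μ {ω | ¬ IntStopped μ ν n m ω}

/-- A rate `L` is average achievable by the interval algorithm: `limsup E[T_n]/n ≤ L`. -/
def IntAvgAchievable [LinearOrder 𝒳] [Fintype 𝒳] [LinearOrder 𝒴] [Fintype 𝒴]
    [MeasurableSpace 𝒳] [MeasurableSpace 𝒴]
    (μ : Measure (ℕ → 𝒳)) (ν : Measure (ℕ → 𝒴)) (L : ℝ≥0∞) : Prop :=
  limsup (fun n : ℕ => intAvgT μ ν n / (n : ℝ≥0∞)) atTop ≤ L

/-- `L⋆_int(X,Y)` : the infimum average achievable rate of the interval algorithm. -/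
def Lint [LinearOrder 𝒳] [Fintype 𝒳] [LinearOrder 𝒴] [Fintype 𝒴]
    [MeasurableSpace 𝒳] [MeasurableSpace 𝒴]
    (μ : Measure (ℕ → 𝒳)) (ν : Measure (ℕ → 𝒴)) : ℝ≥0∞ :=
  sInf {L : ℝ≥0∞ | IntAvgAchievable μ ν L}

/-- A rate `L` is average achievable by some sequence of valid algorithms. -/
def AvgAchievable [MeasurableSpace 𝒳] [MeasurableSpace 𝒴]
    (μ : Measure (ℕ → 𝒳)) (ν : Measure (ℕ → 𝒴)) (L : ℝ≥0∞) : Prop :=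
  ∃ φ : (n : ℕ) → List 𝒳 → Option (Fin n → 𝒴),
    (∀ n : ℕ, Valid μ (fun y : Fin n → 𝒴 => cylP ν y) (φ n)) ∧
    limsup (fun n : ℕ =>
      (∑' m : ℕ, μ {ω | ∀ i ≤ m, φ n (preL ω i) = none}) / (n : ℝ≥0∞)) atTop ≤ L

/-- `L⋆(X,Y)` : the infimum average achievable rate over all valid algorithms. -/
def Lstar [MeasurableSpace 𝒳] [MeasurableSpace 𝒴]
    (μ : Measure (ℕ → 𝒳)) (ν : Measure (ℕ → 𝒴)) : ℝ≥0∞ :=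
  sInf {L : ℝ≥0∞ | AvgAchievable μ ν L}

/-- The spectral sup-entropy `H̄(X)`: the event `(1/m) log(1/P_{X^m}(X^m)) ≥ λ` is
`P_{X^m}(X^m) ≤ 2^{-mλ}`. -/
def specSup [MeasurableSpace 𝒳] (μ : Measure (ℕ → 𝒳)) : ℝ :=
  sInf {lam : ℝ | Tendsto (fun m : ℕ =>
    (μ {ω | cylP μ (pre ω m) ≤ (2 : ℝ) ^ (-((m : ℝ) * lam))}).toReal) atTop (nhds 0)}

/-- The spectral inf-entropy `H̲(X)`: the event `(1/m) log(1/P_{X^m}(X^m)) ≤ λ` is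
`P_{X^m}(X^m) ≥ 2^{-mλ}`. -/
def specInf [MeasurableSpace 𝒳] (μ : Measure (ℕ → 𝒳)) : ℝ :=
  sSup {lam : ℝ | Tendsto (fun m : ℕ =>
    (μ {ω | (2 : ℝ) ^ (-((m : ℝ) * lam)) ≤ cylP μ (pre ω m)}).toReal) atTop (nhds 0)}

/-- The (sup-)entropy rate `H(X) = limsup (1/m) H(X^m)`. -/
def entRate [MeasurableSpace 𝒳] [Fintype 𝒳] (μ : Measure (ℕ → 𝒳)) : ℝ :=
  limsup (fun m : ℕ =>
    (∑ x : Fin m → 𝒳, cylP μ x * Real.logb 2 (1 / cylP μ x)) / (m : ℝ)) atTop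

/-- Upper-tail condition: `Pr((1/m) log(1/P_{X^m}(X^m)) ≥ H̄(X)+δ) ≤ K/m²` eventually. -/
def UpperTail [MeasurableSpace 𝒳] (μ : Measure (ℕ → 𝒳)) : Prop :=
  ∀ δ : ℝ, 0 < δ → ∃ (K : ℝ) (m₀ : ℕ), ∀ m : ℕ, m₀ ≤ m →
    (μ {ω | cylP μ (pre ω m) ≤ (2 : ℝ) ^ (-((m : ℝ) * (specSup μ + δ)))}).toReal
      ≤ K / (m : ℝ) ^ 2

/-- Lower-tail condition: `Pr((1/m) log(1/P_{X^m}(X^m)) ≤ H̲(X)−δ) ≤ K/m²` eventually. -/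
def LowerTail [MeasurableSpace 𝒳] (μ : Measure (ℕ → 𝒳)) : Prop :=
  ∀ δ : ℝ, 0 < δ → ∃ (K : ℝ) (m₀ : ℕ), ∀ m : ℕ, m₀ ≤ m →
    (μ {ω | (2 : ℝ) ^ (-((m : ℝ) * (specInf μ - δ))) ≤ cylP μ (pre ω m)}).toReal
      ≤ K / (m : ℝ) ^ 2

/-- The finite-dimensional distributions of a Markov chain with initial distribution `q`
and transition matrix `W` (`W x x'` is the transition probability from `x` to `x'`). -/
def markovP (q : 𝒳 → ℝ) (W : 𝒳 → 𝒳 → ℝ) : (m : ℕ) → (Fin m → 𝒳) → ℝ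
  | 0, _ => 1
  | m + 1, x => q (x 0) * ∏ i : Fin m, W (x i.castSucc) (x i.succ)

/-- `μ` is the law of the Markov chain with initial distribution `q` and transition matrix `W`. -/
def IsMarkovMeasure [MeasurableSpace 𝒳] (μ : Measure (ℕ → 𝒳)) (q : 𝒳 → ℝ)
    (W : 𝒳 → 𝒳 → ℝ) : Prop :=
  ∀ (m : ℕ) (x : Fin m → 𝒳), cylP μ x = markovP q W m x

/-- `W` is a (row-)stochastic transition matrix. -/
def IsTransMat [Fintype 𝒳] (W : 𝒳 → 𝒳 → ℝ) : Prop :=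
  (∀ x x', 0 ≤ W x x') ∧ ∀ x, ∑ x', W x x' = 1

/-- Irreducibility: any state reaches any other in some `k ≥ 1` steps. -/
def IrreducibleMat [Fintype 𝒳] [DecidableEq 𝒳] (W : Matrix 𝒳 𝒳 ℝ) : Prop :=
  ∀ x x' : 𝒳, ∃ k : ℕ, 1 ≤ k ∧ 0 < (W ^ k) x x'

/-- `π` is a stationary distribution of `W`. -/
def IsStationary [Fintype 𝒳] (π : 𝒳 → ℝ) (W : 𝒳 → 𝒳 → ℝ) : Prop :=
  (∀ x, 0 ≤ π x) ∧ (∑ x, π x = 1) ∧ ∀ x, ∑ x', π x' * W x' x = π x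

/-- `q` is a probability distribution (initial distribution). -/
def IsInitial [Fintype 𝒳] (q : 𝒳 → ℝ) : Prop :=
  (∀ x, 0 ≤ q x) ∧ ∑ x, q x = 1

/-- The entropy rate `H^W(X) = Σ_{x',x} π(x') W(x|x') log (1/W(x|x'))` of a stationary
Markov chain. -/
def matEnt [Fintype 𝒳] (π : 𝒳 → ℝ) (W : 𝒳 → 𝒳 → ℝ) : ℝ :=
  ∑ x' : 𝒳, ∑ x : 𝒳, π x' * W x' x * Real.logb 2 (1 / W x' x)

/-- The weight `w(ξ) = Pr(Y_1 ∈ 𝒴_ξ)` of the irreducible class `ξ` under the initial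
distribution `q`, where `c` assigns to each state its class. -/
def wgt [Fintype 𝒴] {r : ℕ} (c : 𝒴 → Fin r) (q : 𝒴 → ℝ) (ξ : Fin r) : ℝ :=
  ∑ y ∈ Finset.univ.filter (fun y => c y = ξ), q y

/-- The binary entropy function (base 2). -/
def binEnt (t : ℝ) : ℝ := t * Real.logb 2 (1 / t) + (1 - t) * Real.logb 2 (1 / (1 - t))

end RNG

namespace RNG

variable {𝒳 𝒴 : Type*}

/-! ### Prefixes -/

lemma pre_congr {ω ω' : ℕ → 𝒳} {i m : ℕ} (him : i ≤ m) (h : pre ω m = pre ω' m) :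
    pre ω i = pre ω' i := by
  funext j
  exact congrFun h ⟨j, j.2.trans_le him⟩

lemma preL_eq_ofFn (ω : ℕ → 𝒳) (m : ℕ) : preL ω m = List.ofFn (pre ω m) := by
  apply List.ext_getElem <;> simp [preL, pre]

lemma preL_length (ω : ℕ → 𝒳) (m : ℕ) : (preL ω m).length = m := by
  simp [preL]

lemma preL_eq_iff {ω ω' : ℕ → 𝒳} {m : ℕ} : preL ω m = preL ω' m ↔ pre ω m = pre ω' m := by
  rw [preL_eq_ofFn, preL_eq_ofFn, List.ofFn_inj]

section Measure

variable [MeasurableSpace 𝒳] (μ : Measure (ℕ → 𝒳))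

lemma measurable_pre (m : ℕ) : Measurable (fun ω : ℕ → 𝒳 => pre ω m) :=
  measurable_pi_lambda _ fun i => measurable_pi_apply (i : ℕ)

lemma cylP_eq {m : ℕ} (x : Fin m → 𝒳) : cylP μ x = (μ {ω | pre ω m = x}).toReal := by
  unfold cylP pre
  simp only [funext_iff]

lemma cylP_nonneg {m : ℕ} (x : Fin m → 𝒳) : 0 ≤ cylP μ x := ENNReal.toReal_nonneg

variable [IsProbabilityMeasure μ]

variable [Fintype 𝒳] [DiscreteMeasurableSpace 𝒳]

lemma measurableSet_pre (m : ℕ) (p : (Fin m → 𝒳) → Prop) :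
    MeasurableSet {ω : ℕ → 𝒳 | p (pre ω m)} :=
  measurable_pre m (MeasurableSet.of_discrete (s := {x | p x}))

lemma measurableSet_preL (m : ℕ) (p : List 𝒳 → Prop) :
    MeasurableSet {ω : ℕ → 𝒳 | p (preL ω m)} := by
  simp only [preL_eq_ofFn]
  exact measurableSet_pre m fun x => p (List.ofFn x)

lemma measure_pre {m : ℕ} (p : (Fin m → 𝒳) → Prop) [DecidablePred p] :
    (μ {ω | p (pre ω m)}).toReal = ∑ x ∈ Finset.univ.filter p, cylP μ x := by
  have h : {ω : ℕ → 𝒳 | p (pre ω m)}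
      = ⋃ x ∈ Finset.univ.filter p, {ω : ℕ → 𝒳 | pre ω m = x} := by
    ext ω
    simp
  rw [h, measure_biUnion_finset, ENNReal.toReal_sum fun _ _ => measure_ne_top _ _]
  · exact Finset.sum_congr rfl fun x _ => (cylP_eq μ x).symm
  · intro x _ y _ hxy
    refine Set.disjoint_left.2 fun ω hx hy => hxy ?_
    rw [← (show pre ω m = x from hx), ← (show pre ω m = y from hy)]
  · exact fun x _ => measurableSet_pre m (· = x)

lemma sum_cylP (m : ℕ) : ∑ x : Fin m → 𝒳, cylP μ x = 1 := by
  have h := measure_pre μ (m := m) fun _ => True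
  simpa using h.symm

lemma ae_cylP_pre_pos : ∀ᵐ ω ∂μ, ∀ m, 0 < cylP μ (pre ω m) := by
  rw [ae_all_iff]
  intro m
  have h := measure_pre μ (m := m) fun x => ¬ 0 < cylP μ x
  rw [Finset.sum_eq_zero, ENNReal.toReal_eq_zero_iff] at h
  · exact h.resolve_right (measure_ne_top _ _)
  · intro x hx
    exact le_antisymm (not_lt.1 (Finset.mem_filter.1 hx).2) (cylP_nonneg μ x)

end Measure

/-! ### The intervals of the interval algorithm -/

section Intervals

lemma lexLt_iff [LinearOrder 𝒳] {m : ℕ} {x y : Fin m → 𝒳} :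
    lexLt x y ↔ toLex x < toLex y := Iff.rfl

lemma lexLt_pre_succ [LT 𝒳] {ω ω' : ℕ → 𝒳} {m : ℕ} (h : lexLt (pre ω' m) (pre ω m)) :
    lexLt (pre ω' (m + 1)) (pre ω (m + 1)) := by
  obtain ⟨i, hi, hlt⟩ := h
  refine ⟨i.castSucc, fun j hj => ?_, hlt⟩
  exact hi ⟨j, lt_trans hj i.2⟩ hj

lemma lexLe_of_lexLe_succ [LT 𝒳] {ω ω' : ℕ → 𝒳} {m : ℕ}
    (h : lexLt (pre ω' (m + 1)) (pre ω (m + 1)) ∨ pre ω' (m + 1) = pre ω (m + 1)) :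
    lexLt (pre ω' m) (pre ω m) ∨ pre ω' m = pre ω m := by
  rcases h with ⟨i, hi, hlt⟩ | h
  · by_cases him : (i : ℕ) < m
    · exact Or.inl ⟨⟨i, him⟩, fun j hj => hi j.castSucc hj, hlt⟩
    · refine Or.inr (funext fun j => hi j.castSucc ?_)
      exact Fin.lt_def.2 (lt_of_lt_of_le j.2 (not_lt.1 him))
  · exact Or.inr (pre_congr m.le_succ h)

/-- Left end point of the interval assigned to a string. -/
def lo [LT 𝒳] [Fintype 𝒳] {m : ℕ} (P : (Fin m → 𝒳) → ℝ) (x : Fin m → 𝒳) : ℝ :=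
  ∑ x' ∈ Finset.univ.filter (fun x' => lexLt x' x), P x'

variable [LinearOrder 𝒳] [Fintype 𝒳]

lemma lo_add_eq {m : ℕ} (P : (Fin m → 𝒳) → ℝ) (x : Fin m → 𝒳) :
    lo P x + P x = ∑ x' ∈ Finset.univ.filter (fun x' => lexLt x' x ∨ x' = x), P x' := by
  rw [Finset.filter_or, Finset.sum_union, lo]
  · congr 1
    rw [Finset.filter_eq' Finset.univ x]
    simp
  · rw [Finset.disjoint_left]
    intro y hy hy'
    have h1 := (Finset.mem_filter.1 hy).2
    have h2 := (Finset.mem_filter.1 hy').2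
    rw [h2, lexLt_iff] at h1
    exact lt_irrefl _ h1

lemma lo_nonneg {m : ℕ} {P : (Fin m → 𝒳) → ℝ} (hP : ∀ x, 0 ≤ P x) (x : Fin m → 𝒳) :
    0 ≤ lo P x :=
  Finset.sum_nonneg fun y _ => hP y

lemma lo_add_le_one {m : ℕ} {P : (Fin m → 𝒳) → ℝ} (hP : ∀ x, 0 ≤ P x) (hP1 : ∑ x, P x = 1)
    (x : Fin m → 𝒳) : lo P x + P x ≤ 1 := by
  rw [lo_add_eq, ← hP1]
  exact Finset.sum_le_sum_of_subset_of_nonneg (Finset.filter_subset _ _) fun y _ _ => hP y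

lemma lo_add_le_lo {m : ℕ} {P : (Fin m → 𝒳) → ℝ} (hP : ∀ x, 0 ≤ P x) {x y : Fin m → 𝒳}
    (h : lexLt x y) : lo P x + P x ≤ lo P y := by
  rw [lo_add_eq, lo]
  refine Finset.sum_le_sum_of_subset_of_nonneg ?_ fun z _ _ => hP z
  intro z hz
  simp only [Finset.mem_filter, Finset.mem_univ, true_and, lexLt_iff] at hz h ⊢
  rcases hz with hz | rfl
  · exact hz.trans h
  · exact h

lemma itv_eq {m : ℕ} (P : (Fin m → 𝒳) → ℝ) (x : Fin m → 𝒳) :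
    itv P x = Set.Ico (lo P x) (lo P x + P x) := rfl

lemma disjoint_itv {m : ℕ} {P : (Fin m → 𝒳) → ℝ} (hP : ∀ x, 0 ≤ P x) :
    Pairwise (Function.onFun Disjoint (itv P)) := by
  intro x y hxy
  rw [Function.onFun, itv_eq, itv_eq, Set.disjoint_left]
  intro t ht ht'
  rcases lt_or_gt_of_ne (show toLex x ≠ toLex y from hxy) with h | h
  · have := lo_add_le_lo hP (lexLt_iff.2 h)
    linarith [ht.2, ht'.1]
  · have := lo_add_le_lo hP (lexLt_iff.2 h)
    linarith [ht'.2, ht.1]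

lemma volume_itv {m : ℕ} (P : (Fin m → 𝒳) → ℝ) (x : Fin m → 𝒳) :
    volume (itv P x) = ENNReal.ofReal (P x) := by
  rw [itv_eq, Real.volume_Ico, add_sub_cancel_left]

lemma measurableSet_itv {m : ℕ} (P : (Fin m → 𝒳) → ℝ) (x : Fin m → 𝒳) :
    MeasurableSet (itv P x) := measurableSet_Ico

lemma itv_subset_unit {m : ℕ} {P : (Fin m → 𝒳) → ℝ} (hP : ∀ x, 0 ≤ P x)
    (hP1 : ∑ x, P x = 1) (x : Fin m → 𝒳) : itv P x ⊆ Set.Ico 0 1 :=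
  Set.Ico_subset_Ico (lo_nonneg hP x) (lo_add_le_one hP hP1 x)

lemma volume_biUnion_itv {m : ℕ} {P : (Fin m → 𝒳) → ℝ} (hP : ∀ x, 0 ≤ P x)
    (S : Finset (Fin m → 𝒳)) :
    volume (⋃ x ∈ S, itv P x) = ENNReal.ofReal (∑ x ∈ S, P x) := by
  rw [measure_biUnion_finset ((disjoint_itv hP).set_pairwise _) fun x _ => measurableSet_itv P x,
    ENNReal.ofReal_sum_of_nonneg fun x _ => hP x]
  exact Finset.sum_congr rfl fun x _ => volume_itv P x

lemma volume_unit_diff {m : ℕ} {P : (Fin m → 𝒳) → ℝ} (hP : ∀ x, 0 ≤ P x)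
    (hP1 : ∑ x, P x = 1) : volume (Set.Ico (0 : ℝ) 1 \ ⋃ x, itv P x) = 0 := by
  have h := volume_biUnion_itv hP Finset.univ
  simp only [Finset.mem_univ, Set.iUnion_true, hP1] at h
  rw [measure_sdiff (Set.iUnion_subset fun x => itv_subset_unit hP hP1 x)
    (MeasurableSet.iUnion fun x => measurableSet_itv P x).nullMeasurableSet (by simp [h]), h]
  simp

variable [LinearOrder 𝒴] [Fintype 𝒴]

/-- The total length of the source intervals contained in a given target interval is at most
the length of the latter. -/
lemma sum_subset_itv_le {m n : ℕ} {P : (Fin m → 𝒳) → ℝ} (hP : ∀ x, 0 ≤ P x)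
    {Q : (Fin n → 𝒴) → ℝ} (hQ : ∀ y, 0 ≤ Q y) (y : Fin n → 𝒴) :
    ∑ x ∈ Finset.univ.filter (fun x => itv P x ⊆ itv Q y), P x ≤ Q y := by
  rw [← ENNReal.ofReal_le_ofReal_iff (hQ y), ← volume_biUnion_itv hP, ← volume_itv]
  exact measure_mono (Set.iUnion₂_subset fun x hx => (Finset.mem_filter.1 hx).2)

/-- The total length of the short source intervals that are not contained in any target
interval. -/
lemma sum_not_subset_itv_le {m n : ℕ} {P : (Fin m → 𝒳) → ℝ} (hP : ∀ x, 0 ≤ P x)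
    (hP1 : ∑ x, P x = 1) {Q : (Fin n → 𝒴) → ℝ} (hQ : ∀ y, 0 ≤ Q y) (hQ1 : ∑ y, Q y = 1)
    {l : ℝ} (hl : 0 ≤ l) :
    ∑ x ∈ Finset.univ.filter (fun x => P x ≤ l ∧ ∀ y, ¬ itv P x ⊆ itv Q y), P x
      ≤ ∑ y, min (Q y) (2 * l) := by
  have hmin : ∀ y, 0 ≤ min (Q y) (2 * l) := fun y => le_min (hQ y) (by positivity)
  rw [← ENNReal.ofReal_le_ofReal_iff (Finset.sum_nonneg fun y _ => hmin y),
    ← volume_biUnion_itv hP, ENNReal.ofReal_sum_of_nonneg fun y _ => hmin y]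
  set S := Finset.univ.filter (fun x => P x ≤ l ∧ ∀ y, ¬ itv P x ⊆ itv Q y)
  set A := ⋃ x ∈ S, itv P x
  have hA : A ⊆ (Set.Ico (0 : ℝ) 1 \ ⋃ y, itv Q y) ∪ ⋃ y, A ∩ itv Q y := by
    intro t ht
    by_cases hty : t ∈ ⋃ y, itv Q y
    · right
      rw [← Set.inter_iUnion]
      exact ⟨ht, hty⟩
    · exact Or.inl ⟨Set.iUnion₂_subset (fun x _ => itv_subset_unit hP hP1 x) ht, hty⟩
  have hAy : ∀ y, volume (A ∩ itv Q y) ≤ ENNReal.ofReal (min (Q y) (2 * l)) := by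
    intro y
    rw [ENNReal.ofReal_min, le_min_iff]
    refine ⟨(measure_mono Set.inter_subset_right).trans_eq (volume_itv Q y), ?_⟩
    have hsub : A ∩ itv Q y ⊆ Set.Ico (lo Q y) (lo Q y + l)
        ∪ Set.Ico (lo Q y + Q y - l) (lo Q y + Q y) := by
      rintro t ⟨htA, ht1, ht2⟩
      obtain ⟨x, hx, htx⟩ := Set.mem_iUnion₂.1 htA
      obtain ⟨-, hxl, hxy⟩ := Finset.mem_filter.1 hx
      have hxy := hxy y
      rw [itv_eq] at htx
      rw [itv_eq, itv_eq, Set.Ico_subset_Ico_iff (htx.1.trans_lt htx.2), not_and_or, not_le,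
        not_le] at hxy
      rcases hxy with h | h
      · exact Or.inl ⟨ht1, by linarith [htx.2]⟩
      · exact Or.inr ⟨by linarith [htx.1], ht2⟩
    refine (measure_mono hsub).trans ((measure_union_le _ _).trans_eq ?_)
    rw [Real.volume_Ico, Real.volume_Ico, ← ENNReal.ofReal_add (by linarith) (by linarith)]
    congr 1
    ring
  calc volume A ≤ volume (Set.Ico (0 : ℝ) 1 \ ⋃ y, itv Q y) + volume (⋃ y, A ∩ itv Q y) :=
        (measure_mono hA).trans (measure_union_le _ _)
    _ = volume (⋃ y, A ∩ itv Q y) := by rw [volume_unit_diff hQ hQ1, zero_add]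
    _ ≤ ∑ y, volume (A ∩ itv Q y) := measure_iUnion_fintype_le _ _
    _ ≤ _ := Finset.sum_le_sum fun y _ => hAy y

variable [MeasurableSpace 𝒳] [DiscreteMeasurableSpace 𝒳] (μ : Measure (ℕ → 𝒳))
  [IsProbabilityMeasure μ]

lemma itv_pre_antitone (ω : ℕ → 𝒳) :
    Antitone fun m => itv (fun x : Fin m → 𝒳 => cylP μ x) (pre ω m) := by
  refine antitone_nat_of_succ_le fun m => ?_
  rw [itv_eq, itv_eq]
  apply Set.Ico_subset_Ico
  · rw [lo, lo, ← measure_pre μ fun x => lexLt x (pre ω m),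
      ← measure_pre μ fun x => lexLt x (pre ω (m + 1))]
    exact ENNReal.toReal_mono (measure_ne_top _ _)
      (measure_mono fun ω' h => lexLt_pre_succ h)
  · rw [lo_add_eq, lo_add_eq, ← measure_pre μ fun x => lexLt x (pre ω m) ∨ x = pre ω m,
      ← measure_pre μ fun x => lexLt x (pre ω (m + 1)) ∨ x = pre ω (m + 1)]
    exact ENNReal.toReal_mono (measure_ne_top _ _)
      (measure_mono fun ω' h => lexLe_of_lexLe_succ h)

end Intervals

/-! ### Block entropies -/

lemma logb_one_div_le {p N : ℝ} (hp : 0 < p) (hN : 0 < N) :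
    Real.logb 2 (1 / p) ≤ Real.logb 2 N + 2 / (N * p) := by
  have hu : 0 < 1 / (N * p) := by positivity
  have h1 : Real.logb 2 (1 / p) = Real.logb 2 N + Real.logb 2 (1 / (N * p)) := by
    rw [← Real.logb_mul hN.ne' hu.ne']
    congr 1
    field_simp
  have h2 : Real.logb 2 (1 / (N * p)) ≤ 2 * (1 / (N * p)) := by
    have hlog : (0.5 : ℝ) < Real.log 2 := by linarith [Real.log_two_gt_d9]
    rw [Real.logb, div_le_iff₀ (by linarith)]
    have := Real.log_le_self hu.le
    nlinarith
  rw [h1]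
  linarith [show 2 * (1 / (N * p)) = 2 / (N * p) by ring]

lemma logb_one_div_nonneg {p : ℝ} (hp : 0 ≤ p) (hp1 : p ≤ 1) : 0 ≤ Real.logb 2 (1 / p) := by
  rw [one_div, Real.logb_inv, neg_nonneg]
  exact Real.logb_nonpos one_lt_two hp hp1

section Entropy

lemma cylP_le_one [MeasurableSpace 𝒴] (ν : Measure (ℕ → 𝒴)) [IsProbabilityMeasure ν] {n : ℕ} (y : Fin n → 𝒴) : cylP ν y ≤ 1 :=
  ENNReal.toReal_le_of_le_ofReal zero_le_one (by simpa using prob_le_one)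

lemma card_pos_of_isProbabilityMeasure [Fintype 𝒴] [MeasurableSpace 𝒴] (ν : Measure (ℕ → 𝒴))
    [IsProbabilityMeasure ν] : 0 < Fintype.card 𝒴 := by
  obtain ⟨ω⟩ := nonempty_of_isProbabilityMeasure ν
  exact Fintype.card_pos_iff.2 ⟨ω 0⟩

variable [Fintype 𝒴] [MeasurableSpace 𝒴] (ν : Measure (ℕ → 𝒴))

/-- The entropy of the prefix of length `n`, in bits. -/
def blockEnt (n : ℕ) : ℝ := ∑ y : Fin n → 𝒴, cylP ν y * Real.logb 2 (1 / cylP ν y)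

lemma entRate_eq : entRate ν = limsup (fun n : ℕ => blockEnt ν n / n) atTop := rfl

variable [IsProbabilityMeasure ν]

lemma blockEnt_nonneg (n : ℕ) : 0 ≤ blockEnt ν n :=
  Finset.sum_nonneg fun y _ =>
    mul_nonneg (cylP_nonneg ν y) (logb_one_div_nonneg (cylP_nonneg ν y) (cylP_le_one ν y))

lemma isBoundedUnder_ge_blockEnt :
    IsBoundedUnder (· ≥ ·) atTop fun n : ℕ => blockEnt ν n / n :=
  isBoundedUnder_of ⟨0, fun n => div_nonneg (blockEnt_nonneg ν n) n.cast_nonneg⟩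

variable [DiscreteMeasurableSpace 𝒴]

lemma blockEnt_le (n : ℕ) : blockEnt ν n ≤ n * Real.logb 2 (Fintype.card 𝒴) + 2 := by
  have hc : (0 : ℝ) < Fintype.card 𝒴 := by
    exact_mod_cast card_pos_of_isProbabilityMeasure ν
  set N : ℝ := (Fintype.card 𝒴 : ℝ) ^ n with hN
  have hN0 : 0 < N := pow_pos hc n
  have hlog : Real.logb 2 N = n * Real.logb 2 (Fintype.card 𝒴) := Real.logb_pow _ _ _
  have hterm : ∀ y : Fin n → 𝒴, cylP ν y * Real.logb 2 (1 / cylP ν y)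
      ≤ cylP ν y * Real.logb 2 N + 2 / N := by
    intro y
    rcases (cylP_nonneg ν y).eq_or_lt with h | h
    · rw [← h]
      simp only [zero_mul, zero_add]
      positivity
    · calc _ ≤ cylP ν y * (Real.logb 2 N + 2 / (N * cylP ν y)) :=
            mul_le_mul_of_nonneg_left (logb_one_div_le h hN0) h.le
        _ = _ := by field_simp
  calc blockEnt ν n ≤ ∑ y : Fin n → 𝒴, (cylP ν y * Real.logb 2 N + 2 / N) :=
        Finset.sum_le_sum fun y _ => hterm y
    _ = Real.logb 2 N + 2 := by
        rw [Finset.sum_add_distrib, ← Finset.sum_mul, sum_cylP, one_mul, Finset.sum_const,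
          Finset.card_univ, Fintype.card_fun, Fintype.card_fin, nsmul_eq_mul, Nat.cast_pow, ← hN]
        field_simp
    _ = _ := by rw [hlog]

lemma isBoundedUnder_blockEnt :
    IsBoundedUnder (· ≤ ·) atTop fun n : ℕ => blockEnt ν n / n := by
  refine isBoundedUnder_of_eventually_le (a := Real.logb 2 (Fintype.card 𝒴) + 2) ?_
  filter_upwards [eventually_ge_atTop 1] with n hn
  have hn' : (1 : ℝ) ≤ n := by exact_mod_cast hn
  rw [div_le_iff₀ (by linarith)]
  linarith [blockEnt_le ν n]

end Entropy

/-! ### The interval algorithm: upper bound on the expected stopping time -/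

lemma sum_range_min_le {p h : ℝ} (hp : 0 ≤ p) (hp1 : p ≤ 1) (hh : 0 < h) (M : ℕ) :
    ∑ m ∈ Finset.range M, min p (2 * (2 : ℝ) ^ (-((m : ℝ) * h)))
      ≤ p * Real.logb 2 (1 / p) / h + p * (1 + 2 / (1 - (2 : ℝ) ^ (-h))) := by
  rcases hp.eq_or_lt with rfl | hp
  · simp only [zero_mul, zero_div, add_zero]
    exact Finset.sum_nonpos fun m _ => min_le_left _ _
  set r : ℝ := (2 : ℝ) ^ (-h) with hr
  have hr0 : 0 < r := Real.rpow_pos_of_pos two_pos _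
  have hr1 : r < 1 := Real.rpow_lt_one_of_one_lt_of_neg one_lt_two (by linarith)
  have hpow : ∀ m : ℕ, (2 : ℝ) ^ (-((m : ℝ) * h)) = r ^ m := by
    intro m
    rw [hr, ← Real.rpow_natCast, ← Real.rpow_mul two_pos.le]
    congr 1
    ring
  simp only [hpow]
  have hlog := logb_one_div_nonneg hp.le hp1
  set k := ⌈Real.logb 2 (1 / p) / h⌉₊
  have hk : (k : ℝ) ≤ Real.logb 2 (1 / p) / h + 1 := (Nat.ceil_lt_add_one (by positivity)).le
  have hrk : r ^ k ≤ p := by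
    have hle : Real.logb 2 (1 / p) ≤ k * h := by
      rw [← div_le_iff₀ hh]
      exact Nat.le_ceil _
    calc r ^ k = (2 : ℝ) ^ (-((k : ℝ) * h)) := (hpow k).symm
      _ ≤ (2 : ℝ) ^ (-Real.logb 2 (1 / p)) :=
          Real.rpow_le_rpow_of_exponent_le one_le_two (by linarith)
      _ = p := by
          rw [one_div, Real.logb_inv, neg_neg, Real.rpow_logb two_pos (by norm_num) hp]
  have hgeom : ∑ j ∈ Finset.range M, r ^ j ≤ 1 / (1 - r) := by
    rw [le_div_iff₀ (by linarith), geom_sum_mul_neg]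
    linarith [pow_pos hr0 M]
  calc ∑ m ∈ Finset.range M, min p (2 * r ^ m)
      ≤ ∑ m ∈ Finset.range (k + M), min p (2 * r ^ m) :=
        Finset.sum_le_sum_of_subset_of_nonneg (Finset.range_mono (Nat.le_add_left _ _))
          fun m _ _ => le_min hp.le (by positivity)
    _ = ∑ m ∈ Finset.range k, min p (2 * r ^ m)
          + ∑ j ∈ Finset.range M, min p (2 * r ^ (k + j)) := Finset.sum_range_add _ _ _
    _ ≤ ∑ m ∈ Finset.range k, p + ∑ j ∈ Finset.range M, 2 * p * r ^ j := by
        refine add_le_add (Finset.sum_le_sum fun m _ => min_le_left _ _)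
          (Finset.sum_le_sum fun j _ => (min_le_right _ _).trans ?_)
        rw [pow_add]
        nlinarith [mul_le_mul_of_nonneg_right hrk (pow_pos hr0 j).le]
    _ ≤ p * (Real.logb 2 (1 / p) / h + 1) + 2 * p * (1 / (1 - r)) := by
        rw [← Finset.mul_sum, Finset.sum_const, Finset.card_range, nsmul_eq_mul, mul_comm (k : ℝ)]
        gcongr
    _ = _ := by ring

lemma tsum_ne_top_of_toReal_le {u : ℕ → ℝ≥0∞} (hu : ∀ m, u m ≠ ⊤) {K : ℝ} {m₀ : ℕ}
    (h : ∀ m, m₀ ≤ m → (u m).toReal ≤ K / (m : ℝ) ^ 2) : ∑' m, u m ≠ ⊤ := by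
  have hs : Summable fun m => (u m).toReal := by
    have h2 : Summable fun m : ℕ => K / (m : ℝ) ^ 2 := by
      simpa [div_eq_mul_inv] using (Real.summable_nat_pow_inv.2 one_lt_two).mul_left K
    refine (summable_nat_add_iff m₀).1 (Summable.of_nonneg_of_le
      (fun m => ENNReal.toReal_nonneg) (fun m => h (m + m₀) (Nat.le_add_left _ _))
      ((summable_nat_add_iff m₀).2 h2))
  have := hs.tsum_ofReal_ne_top
  simpa only [ENNReal.ofReal_toReal (hu _)] using this

section Upper

variable [Fintype 𝒳] [LinearOrder 𝒳] [MeasurableSpace 𝒳] [DiscreteMeasurableSpace 𝒳]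
  [Fintype 𝒴] [LinearOrder 𝒴] [MeasurableSpace 𝒴] [DiscreteMeasurableSpace 𝒴]
  (μ : Measure (ℕ → 𝒳)) [IsProbabilityMeasure μ] (ν : Measure (ℕ → 𝒴)) [IsProbabilityMeasure ν]

lemma measure_not_intStopped_le (n m : ℕ) {l : ℝ} (hl : 0 ≤ l) :
    μ {ω | ¬ IntStopped μ ν n m ω} ≤ μ {ω | l ≤ cylP μ (pre ω m)}
      + ENNReal.ofReal (∑ y : Fin n → 𝒴, min (cylP ν y) (2 * l)) := by
  have hsub : {ω | ¬ IntStopped μ ν n m ω} ⊆ {ω | l ≤ cylP μ (pre ω m)}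
      ∪ {ω | cylP μ (pre ω m) ≤ l ∧ ∀ y : Fin n → 𝒴,
        ¬ itv (fun x : Fin m → 𝒳 => cylP μ x) (pre ω m) ⊆ itv (fun y' => cylP ν y') y} := by
    intro ω hω
    rcases le_total l (cylP μ (pre ω m)) with h | h
    · exact Or.inl h
    · exact Or.inr ⟨h, not_exists.1 hω⟩
  refine (measure_mono hsub).trans ((measure_union_le _ _).trans ?_)
  gcongr
  rw [← ENNReal.ofReal_toReal (measure_ne_top μ {ω | cylP μ (pre ω m) ≤ l ∧ _}),
    measure_pre μ fun x => cylP μ x ≤ l ∧ ∀ y : Fin n → 𝒴,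
      ¬ itv (fun x : Fin m → 𝒳 => cylP μ x) x ⊆ itv (fun y' => cylP ν y') y]
  exact ENNReal.ofReal_le_ofReal (sum_not_subset_itv_le (cylP_nonneg μ) (sum_cylP μ m)
    (cylP_nonneg ν) (sum_cylP ν n) hl)

lemma intAvgT_le {h : ℝ} (hh : 0 < h) (n : ℕ) :
    intAvgT μ ν n ≤ ∑' m : ℕ, μ {ω | (2 : ℝ) ^ (-((m : ℝ) * h)) ≤ cylP μ (pre ω m)}
      + ENNReal.ofReal (blockEnt ν n / h + (1 + 2 / (1 - (2 : ℝ) ^ (-h)))) := by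
  have hnn : ∀ (m : ℕ) (y : Fin n → 𝒴),
      0 ≤ min (cylP ν y) (2 * (2 : ℝ) ^ (-((m : ℝ) * h))) := fun m y =>
    le_min (cylP_nonneg ν y) (by positivity)
  refine (ENNReal.tsum_le_tsum fun m => measure_not_intStopped_le μ ν n m
    (Real.rpow_nonneg two_pos.le (-((m : ℝ) * h)))).trans ?_
  rw [ENNReal.tsum_add]
  gcongr
  refine ENNReal.tsum_le_of_sum_range_le fun M => ?_
  rw [← ENNReal.ofReal_sum_of_nonneg fun m _ => Finset.sum_nonneg fun y _ => hnn m y,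
    Finset.sum_comm]
  refine ENNReal.ofReal_le_ofReal ((Finset.sum_le_sum fun y _ => sum_range_min_le
    (cylP_nonneg ν y) (cylP_le_one ν y) hh M).trans_eq ?_)
  rw [Finset.sum_add_distrib, ← Finset.sum_mul, sum_cylP, one_mul, ← Finset.sum_div, blockEnt]

/-- A lower-tail bound on the coin process makes every rate above `H(Y) / h` average achievable
by the interval algorithm. -/
lemma limsup_intAvgT_le {h : ℝ} (hh : 0 < h)
    (htail : ∑' m : ℕ, μ {ω | (2 : ℝ) ^ (-((m : ℝ) * h)) ≤ cylP μ (pre ω m)} ≠ ⊤)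
    {ε : ℝ} (hε : 0 < ε) :
    IntAvgAchievable μ ν (ENNReal.ofReal ((entRate ν + ε) / h + ε)) := by
  set t := ∑' m : ℕ, μ {ω | (2 : ℝ) ^ (-((m : ℝ) * h)) ≤ cylP μ (pre ω m)}
  set C : ℝ := t.toReal + |1 + 2 / (1 - (2 : ℝ) ^ (-h))| with hC
  have hC0 : 0 ≤ C := add_nonneg ENNReal.toReal_nonneg (abs_nonneg _)
  have hbound : ∀ n, intAvgT μ ν n ≤ ENNReal.ofReal (blockEnt ν n / h + C) := by
    intro n
    have hb := div_nonneg (blockEnt_nonneg ν n) hh.le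
    calc intAvgT μ ν n ≤ t + ENNReal.ofReal (blockEnt ν n / h + (1 + 2 / (1 - (2 : ℝ) ^ (-h)))) :=
          intAvgT_le μ ν hh n
      _ ≤ ENNReal.ofReal t.toReal
          + ENNReal.ofReal (blockEnt ν n / h + |1 + 2 / (1 - (2 : ℝ) ^ (-h))|) := by
          rw [ENNReal.ofReal_toReal htail]
          gcongr
          exact le_abs_self _
      _ = _ := by
          rw [← ENNReal.ofReal_add ENNReal.toReal_nonneg (add_nonneg hb (abs_nonneg _)), hC]
          congr 1
          ring
  refine limsup_le_of_le (by isBoundedDefault) ?_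
  have hlt : ∀ᶠ n : ℕ in atTop, blockEnt ν n / n < entRate ν + ε :=
    eventually_lt_of_limsup_lt (by rw [← entRate_eq]; linarith) (isBoundedUnder_blockEnt ν)
  have hCn : ∀ᶠ n : ℕ in atTop, C / n < ε :=
    (tendsto_const_div_atTop_nhds_zero_nat C).eventually_lt_const hε
  filter_upwards [hlt, hCn, eventually_gt_atTop 0] with n h1 h2 h3
  have hn : (0 : ℝ) < n := by exact_mod_cast h3
  rw [← ENNReal.ofReal_natCast]
  refine (ENNReal.div_le_div_right (hbound n) _).trans ?_
  rw [← ENNReal.ofReal_div_of_pos hn]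
  apply ENNReal.ofReal_le_ofReal
  have h4 : (blockEnt ν n / h + C) / n = (blockEnt ν n / n) / h + C / n := by
    field_simp
  rw [h4]
  gcongr

end Upper

/-! ### The interval algorithm as a valid algorithm -/

section Validity

variable [Fintype 𝒳] [LinearOrder 𝒳] [MeasurableSpace 𝒳]
  [Fintype 𝒴] [LinearOrder 𝒴] [MeasurableSpace 𝒴]
  (μ : Measure (ℕ → 𝒳)) (ν : Measure (ℕ → 𝒴))

/-- The interval algorithm as a function on finite coin strings. -/
def intAlg (n : ℕ) (l : List 𝒳) : Option (Fin n → 𝒴) :=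
  if h : ∃ y : Fin n → 𝒴, ∃ (m : ℕ) (ω : ℕ → 𝒳), preL ω m = l ∧
      itv (fun x : Fin m → 𝒳 => cylP μ x) (pre ω m) ⊆ itv (fun y' => cylP ν y') y
  then some h.choose else none

variable {μ ν}

lemma not_intStopped_of_intAlg_eq_none {n m : ℕ} {ω : ℕ → 𝒳}
    (h : intAlg μ ν n (preL ω m) = none) : ¬ IntStopped μ ν n m ω := by
  rintro ⟨y, hy⟩
  rw [intAlg, dif_pos ⟨y, m, ω, rfl, hy⟩] at h
  exact Option.some_ne_none _ h

lemma itv_subset_of_intAlg_eq_some {n m : ℕ} {ω : ℕ → 𝒳} {y : Fin n → 𝒴}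
    (h : intAlg μ ν n (preL ω m) = some y) :
    itv (fun x : Fin m → 𝒳 => cylP μ x) (pre ω m) ⊆ itv (fun y' => cylP ν y') y := by
  unfold intAlg at h
  split_ifs at h with hex
  obtain ⟨m', ω', hpre, hsub⟩ := hex.choose_spec
  rw [Option.some.inj h] at hsub
  obtain rfl : m' = m := by simpa [preL_length] using congrArg List.length hpre
  rwa [preL_eq_iff.1 hpre] at hsub

variable [DiscreteMeasurableSpace 𝒳] [IsProbabilityMeasure μ]

variable (μ ν) in
lemma measure_output_intAlg_le (n : ℕ) (y : Fin n → 𝒴) :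
    μ {ω | ∃ i : ℕ, intAlg μ ν n (preL ω i) = some y ∧ ∀ j < i, intAlg μ ν n (preL ω j) = none}
      ≤ ENNReal.ofReal (cylP ν y) := by
  set A : ℕ → Set (ℕ → 𝒳) := fun m =>
    {ω | itv (fun x : Fin m → 𝒳 => cylP μ x) (pre ω m) ⊆ itv (fun y' => cylP ν y') y}
  have hA : Monotone A := fun i j hij ω hω => (itv_pre_antitone μ ω hij).trans hω
  have hsub : {ω | ∃ i : ℕ, intAlg μ ν n (preL ω i) = some y ∧
      ∀ j < i, intAlg μ ν n (preL ω j) = none} ⊆ ⋃ m, A m := fun ω ⟨i, hi, _⟩ =>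
    Set.mem_iUnion.2 ⟨i, itv_subset_of_intAlg_eq_some hi⟩
  calc _ ≤ μ (⋃ m, A m) := measure_mono hsub
    _ = ⨆ m, μ (A m) := hA.measure_iUnion
    _ ≤ _ := by
      refine iSup_le fun m => ?_
      rw [← ENNReal.ofReal_toReal (measure_ne_top μ (A m))]
      refine ENNReal.ofReal_le_ofReal ?_
      rw [measure_pre μ fun x =>
        itv (fun x : Fin m → 𝒳 => cylP μ x) x ⊆ itv (fun y' => cylP ν y') y]
      exact sum_subset_itv_le (cylP_nonneg μ) (cylP_nonneg ν) y

variable [DiscreteMeasurableSpace 𝒴] [IsProbabilityMeasure ν]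

lemma valid_intAlg {n : ℕ} (hfin : intAvgT μ ν n ≠ ⊤) :
    Valid μ (fun y : Fin n → 𝒴 => cylP ν y) (intAlg μ ν n) := by
  set G : (Fin n → 𝒴) → Set (ℕ → 𝒳) := fun y => {ω | ∃ i : ℕ,
    intAlg μ ν n (preL ω i) = some y ∧ ∀ j < i, intAlg μ ν n (preL ω j) = none} with hG
  have hle : ∀ y, (μ (G y)).toReal ≤ cylP ν y := fun y =>
    ENNReal.toReal_le_of_le_ofReal (cylP_nonneg ν y) (measure_output_intAlg_le μ ν n y)
  have hnull : μ (⋃ y, G y)ᶜ = 0 := by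
    have hle : ∀ m, μ (⋃ y, G y)ᶜ ≤ μ {ω | ¬ IntStopped μ ν n m ω} := by
      refine fun m => measure_mono fun ω hω => ?_
      have hnone : ∀ i, intAlg μ ν n (preL ω i) = none := by
        intro i
        induction i using Nat.strong_induction_on with
        | _ i ih =>
          rw [Option.eq_none_iff_forall_ne_some]
          exact fun y hy => hω (Set.mem_iUnion.2 ⟨y, i, hy, ih⟩)
      exact not_intStopped_of_intAlg_eq_none (hnone m)
    exact le_antisymm (ge_of_tendsto' (ENNReal.tendsto_atTop_zero_of_tsum_ne_top hfin) hle)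
      zero_le
  have hge : (1 : ℝ) ≤ ∑ y, (μ (G y)).toReal := by
    rw [← ENNReal.toReal_sum fun _ _ => measure_ne_top _ _, ← ENNReal.toReal_one]
    refine ENNReal.toReal_mono (ENNReal.sum_ne_top.2 fun _ _ => measure_ne_top _ _) ?_
    calc (1 : ℝ≥0∞) = μ Set.univ := measure_univ.symm
      _ ≤ μ (⋃ y, G y) + μ (⋃ y, G y)ᶜ := measure_univ_le_add_compl _
      _ = μ (⋃ y, G y) := by rw [hnull, add_zero]
      _ ≤ _ := measure_iUnion_fintype_le _ _
  have heq := (Finset.sum_eq_sum_iff_of_le fun y (_ : y ∈ Finset.univ) => hle y).1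
    (le_antisymm (Finset.sum_le_sum fun y _ => hle y) ((sum_cylP ν n).trans_le hge))
  exact fun y => heq y (Finset.mem_univ y)

lemma Lstar_le_Lint (hfin : ∀ n, intAvgT μ ν n ≠ ⊤) : Lstar μ ν ≤ Lint μ ν := by
  refine sInf_le_sInf fun L hL => ⟨intAlg μ ν, fun n => valid_intAlg (hfin n), ?_⟩
  refine le_trans (limsup_le_limsup (Eventually.of_forall fun n => ?_)) hL
  refine ENNReal.div_le_div_right (ENNReal.tsum_le_tsum fun m => measure_mono fun ω hω => ?_) _
  exact not_intStopped_of_intAlg_eq_none (hω m le_rfl)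

end Validity

/-! ### Lower bound for arbitrary algorithms -/

section Lower

variable {B : Type*}

/-- The set of samples on which the algorithm `φ` outputs `y`. -/
def outputSet (φ : List 𝒳 → Option B) (y : B) : Set (ℕ → 𝒳) :=
  {ω | ∃ i : ℕ, φ (preL ω i) = some y ∧ ∀ j < i, φ (preL ω j) = none}

/-- The set of samples on which the algorithm `φ` has not stopped after `m` coin symbols. -/
def runningSet (φ : List 𝒳 → Option B) (m : ℕ) : Set (ℕ → 𝒳) :=
  {ω | ∀ i ≤ m, φ (preL ω i) = none}

lemma outputSet_unique {φ : List 𝒳 → Option B} {y z : B} {ω : ℕ → 𝒳}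
    (hy : ω ∈ outputSet φ y) (hz : ω ∈ outputSet φ z) : y = z := by
  obtain ⟨i, hi, hi'⟩ := hy
  obtain ⟨j, hj, hj'⟩ := hz
  rcases lt_trichotomy i j with h | rfl | h
  · simp [hj' i h] at hi
  · exact Option.some.inj (hi.symm.trans hj)
  · simp [hi' j h] at hj

lemma preL_congr {ω ω' : ℕ → 𝒳} {i m : ℕ} (him : i ≤ m) (h : pre ω m = pre ω' m) :
    preL ω i = preL ω' i :=
  preL_eq_iff.2 (pre_congr him h)

lemma natCast_le_tsum_indicator {φ : List 𝒳 → Option B} {ω : ℕ → 𝒳} {i : ℕ}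
    (hi : ∀ j < i, φ (preL ω j) = none) :
    (i : ℝ≥0∞) ≤ ∑' m, (runningSet φ m).indicator 1 ω := by
  calc (i : ℝ≥0∞) = ∑ m ∈ Finset.range i, (runningSet φ m).indicator 1 ω := by
        rw [Finset.sum_congr rfl (g := fun _ => (1 : ℝ≥0∞))]
        · simp
        · intro m hm
          refine Set.indicator_of_mem (fun j hj => ?_) _
          exact hi j (hj.trans_lt (Finset.mem_range.1 hm))
    _ ≤ _ := ENNReal.sum_le_tsum _

section

variable [MeasurableSpace 𝒳] [Fintype 𝒳] [DiscreteMeasurableSpace 𝒳]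

lemma measurableSet_runningSet (φ : List 𝒳 → Option B) (m : ℕ) :
    MeasurableSet (runningSet φ m) := by
  have : runningSet φ m = ⋂ i, ⋂ (_ : i ≤ m), {ω | φ (preL ω i) = none} := by
    ext ω
    simp [runningSet]
  rw [this]
  exact MeasurableSet.iInter fun i => MeasurableSet.iInter fun _ =>
    measurableSet_preL i fun l => φ l = none

lemma measurableSet_outputSet (φ : List 𝒳 → Option B) (y : B) :
    MeasurableSet (outputSet φ y) := by
  have : outputSet φ y = ⋃ i, ({ω | φ (preL ω i) = some y} ∩
      ⋂ j, ⋂ (_ : j < i), {ω | φ (preL ω j) = none}) := by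
    ext ω
    simp [outputSet]
  rw [this]
  exact MeasurableSet.iUnion fun i => (measurableSet_preL i fun l => φ l = some y).inter
    (MeasurableSet.iInter fun j => MeasurableSet.iInter fun _ =>
      measurableSet_preL j fun l => φ l = none)

end

variable [MeasurableSpace 𝒳] (μ : Measure (ℕ → 𝒳))

/-- Samples on which some prefix of length at least `M` is less likely than `2 ^ (-m * a)`. -/
def atypicalSet (a : ℝ) (M : ℕ) : Set (ℕ → 𝒳) :=
  ⋃ k : ℕ, {ω | cylP μ (pre ω (k + M)) ≤ (2 : ℝ) ^ (-(((k + M : ℕ) : ℝ) * a))}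

lemma measurableSet_atypicalSet [Fintype 𝒳] [DiscreteMeasurableSpace 𝒳] (a : ℝ) (M : ℕ) : MeasurableSet (atypicalSet μ a M) :=
  MeasurableSet.iUnion fun k =>
    measurableSet_pre (k + M) fun x => cylP μ x ≤ (2 : ℝ) ^ (-(((k + M : ℕ) : ℝ) * a))

variable [IsProbabilityMeasure μ]

lemma cylP_le_measure_outputSet {φ : List 𝒳 → Option B} {y : B} {ω : ℕ → 𝒳} {i : ℕ}
    (hi : φ (preL ω i) = some y) (hi' : ∀ j < i, φ (preL ω j) = none) :
    cylP μ (pre ω i) ≤ (μ (outputSet φ y)).toReal := by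
  rw [cylP_eq]
  refine ENNReal.toReal_mono (measure_ne_top _ _) (measure_mono fun ω' hω' => ?_)
  refine ⟨i, ?_, fun j hj => ?_⟩
  · rwa [preL_congr le_rfl hω']
  · rw [preL_congr hj.le hω']
    exact hi' j hj

variable [Fintype 𝒳]

/-- A bound on the information of short coin strings. -/
def shortInfo (M : ℕ) : ℝ := ∑ m ∈ Finset.range M, ∑ x : Fin m → 𝒳, Real.logb 2 (1 / cylP μ x)

lemma logb_le_shortInfo {i M : ℕ} (hi : i < M) (x : Fin i → 𝒳) :
    Real.logb 2 (1 / cylP μ x) ≤ shortInfo μ M := by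
  have hnn : ∀ (m : ℕ) (x : Fin m → 𝒳), 0 ≤ Real.logb 2 (1 / cylP μ x) := fun m x =>
    logb_one_div_nonneg (cylP_nonneg μ x) (cylP_le_one μ x)
  exact (Finset.single_le_sum (fun x _ => hnn i x) (Finset.mem_univ x)).trans
    (Finset.single_le_sum (f := fun m => ∑ x : Fin m → 𝒳, Real.logb 2 (1 / cylP μ x))
      (fun m _ => Finset.sum_nonneg fun x _ => hnn m x) (Finset.mem_range.2 hi))

lemma shortInfo_nonneg (M : ℕ) : 0 ≤ shortInfo μ M :=
  Finset.sum_nonneg fun _ _ => Finset.sum_nonneg fun x _ =>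
    logb_one_div_nonneg (cylP_nonneg μ x) (cylP_le_one μ x)

variable [DiscreteMeasurableSpace 𝒳]

variable [Fintype 𝒴] [MeasurableSpace 𝒴] (ν : Measure (ℕ → 𝒴)) [IsProbabilityMeasure ν]

lemma ae_info_output_le {φ : List 𝒳 → Option B} {a N : ℝ} (ha : 0 ≤ a) (hN : 0 < N) (M : ℕ) :
    ∀ᵐ ω ∂μ, ∀ y, ω ∈ outputSet φ y →
      ENNReal.ofReal (Real.logb 2 (1 / (μ (outputSet φ y)).toReal))
        ≤ ENNReal.ofReal a * ∑' m, (runningSet φ m).indicator 1 ω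
          + ENNReal.ofReal (shortInfo μ M)
          + ENNReal.ofReal (Real.logb 2 N) * (atypicalSet μ a M).indicator 1 ω
          + ENNReal.ofReal (2 / (N * (μ (outputSet φ y)).toReal)) := by
  filter_upwards [ae_cylP_pre_pos μ] with ω hω y ⟨i, hi, hi'⟩
  have hle := cylP_le_measure_outputSet μ hi hi'
  have hpos := (hω i).trans_le hle
  have hlog : Real.logb 2 (1 / (μ (outputSet φ y)).toReal)
      ≤ Real.logb 2 (1 / cylP μ (pre ω i)) :=
    Real.logb_le_logb_of_le one_lt_two (by positivity) (one_div_le_one_div_of_le (hω i) hle)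
  by_cases hat : ω ∈ atypicalSet μ a M
  · rw [Set.indicator_of_mem hat, Pi.one_apply, mul_one]
    refine (ENNReal.ofReal_le_ofReal (logb_one_div_le hpos hN)).trans
      (ENNReal.ofReal_add_le.trans ?_)
    gcongr
    exact le_add_self
  · refine le_trans ?_ (le_self_add.trans le_self_add)
    rcases lt_or_ge i M with h | h
    · exact (ENNReal.ofReal_le_ofReal (hlog.trans (logb_le_shortInfo μ h _))).trans le_add_self
    · refine le_trans ?_ le_self_add
      have hgt : (2 : ℝ) ^ (-((i : ℝ) * a)) < cylP μ (pre ω i) := by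
        by_contra hcon
        refine hat (Set.mem_iUnion.2 ⟨i - M, ?_⟩)
        rw [Set.mem_ofPred_eq, Nat.sub_add_cancel h]
        exact not_lt.1 hcon
      have hlog2 : Real.logb 2 (1 / cylP μ (pre ω i)) ≤ a * i := by
        have := Real.logb_le_logb_of_le one_lt_two (Real.rpow_pos_of_pos two_pos _) hgt.le
        rw [Real.logb_rpow two_pos (by norm_num)] at this
        rw [one_div, Real.logb_inv]
        linarith
      calc _ ≤ ENNReal.ofReal (a * i) := ENNReal.ofReal_le_ofReal (hlog.trans hlog2)
        _ = ENNReal.ofReal a * i := by rw [ENNReal.ofReal_mul ha, ENNReal.ofReal_natCast]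
        _ ≤ _ := by
          gcongr
          exact natCast_le_tsum_indicator hi'

lemma blockEnt_le_of_valid {n : ℕ} {φ : List 𝒳 → Option (Fin n → 𝒴)}
    (hφ : Valid μ (fun y : Fin n → 𝒴 => cylP ν y) φ) {a : ℝ} (ha : 0 ≤ a) (M : ℕ) :
    ENNReal.ofReal (blockEnt ν n) ≤ ENNReal.ofReal a * ∑' m, μ (runningSet φ m)
      + ENNReal.ofReal (shortInfo μ M)
      + ENNReal.ofReal (n * Real.logb 2 (Fintype.card 𝒴)) * μ (atypicalSet μ a M)
      + ENNReal.ofReal 2 := by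
  have hc : (0 : ℝ) < Fintype.card 𝒴 := by
    exact_mod_cast card_pos_of_isProbabilityMeasure ν
  set N : ℝ := (Fintype.card 𝒴 : ℝ) ^ n with hN
  have hN0 : 0 < N := pow_pos hc n
  have hlogN : Real.logb 2 N = n * Real.logb 2 (Fintype.card 𝒴) := Real.logb_pow _ _ _
  have hG : ∀ y, (μ (outputSet φ y)).toReal = cylP ν y := hφ
  have hG' : ∀ y, μ (outputSet φ y) = ENNReal.ofReal (cylP ν y) := fun y => by
    rw [← hG, ENNReal.ofReal_toReal (measure_ne_top _ _)]
  have hmG := measurableSet_outputSet φ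
  set v : (Fin n → 𝒴) → ℝ≥0∞ := fun y => ENNReal.ofReal (Real.logb 2 (1 / cylP ν y))
  set w : (Fin n → 𝒴) → ℝ≥0∞ := fun y => ENNReal.ofReal (2 / (N * cylP ν y))
  have hint : ∀ u : (Fin n → 𝒴) → ℝ≥0∞,
      ∫⁻ ω, ∑ y, (outputSet φ y).indicator (fun _ => u y) ω ∂μ
        = ∑ y, ENNReal.ofReal (cylP ν y) * u y := by
    intro u
    rw [lintegral_finsetSum _ fun y _ => measurable_const.indicator (hmG y)]
    refine Finset.sum_congr rfl fun y _ => ?_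
    rw [lintegral_indicator_const (hmG y), hG', mul_comm]
  have hleft : ENNReal.ofReal (blockEnt ν n)
      = ∫⁻ ω, ∑ y, (outputSet φ y).indicator (fun _ => v y) ω ∂μ := by
    have hl : ∀ y : Fin n → 𝒴, 0 ≤ Real.logb 2 (1 / cylP ν y) := fun y =>
      logb_one_div_nonneg (cylP_nonneg ν y) (cylP_le_one ν y)
    rw [hint, blockEnt, ENNReal.ofReal_sum_of_nonneg fun y _ =>
      mul_nonneg (cylP_nonneg ν y) (hl y)]
    exact Finset.sum_congr rfl fun y _ => ENNReal.ofReal_mul (cylP_nonneg ν y)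
  have hright : ∫⁻ ω, ∑ y, (outputSet φ y).indicator (fun _ => w y) ω ∂μ ≤ ENNReal.ofReal 2 := by
    rw [hint]
    calc _ ≤ ∑ _y : Fin n → 𝒴, ENNReal.ofReal (2 / N) := by
          refine Finset.sum_le_sum fun y _ => ?_
          rw [← ENNReal.ofReal_mul (cylP_nonneg ν y)]
          refine ENNReal.ofReal_le_ofReal ?_
          rcases (cylP_nonneg ν y).eq_or_lt with h | h
          · rw [← h, zero_mul]
            positivity
          · exact le_of_eq (by field_simp)
      _ = ENNReal.ofReal 2 := by
          rw [← ENNReal.ofReal_sum_of_nonneg fun _ _ => by positivity, Finset.sum_const,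
            Finset.card_univ, Fintype.card_fun, Fintype.card_fin, nsmul_eq_mul, Nat.cast_pow,
            ← hN, mul_div_cancel₀ _ hN0.ne']
  have hpt : ∀ᵐ ω ∂μ, ∑ y, (outputSet φ y).indicator (fun _ => v y) ω
      ≤ ENNReal.ofReal a * ∑' m, (runningSet φ m).indicator 1 ω
          + ENNReal.ofReal (shortInfo μ M)
          + ENNReal.ofReal (Real.logb 2 N) * (atypicalSet μ a M).indicator 1 ω
          + ∑ y, (outputSet φ y).indicator (fun _ => w y) ω := by
    filter_upwards [ae_info_output_le μ (φ := φ) ha hN0 M] with ω hω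
    by_cases hex : ∃ y, ω ∈ outputSet φ y
    · obtain ⟨y, hy⟩ := hex
      have hsum : ∀ u : (Fin n → 𝒴) → ℝ≥0∞,
          ∑ z, (outputSet φ z).indicator (fun _ => u z) ω = u y := by
        intro u
        rw [Finset.sum_eq_single y, Set.indicator_of_mem hy]
        · intro z _ hzy
          exact Set.indicator_of_notMem (fun hz => hzy (outputSet_unique hz hy)) _
        · simp
      rw [hsum, hsum]
      have := hω y hy
      rwa [hG] at this
    · rw [Finset.sum_eq_zero fun y _ => Set.indicator_of_notMem (fun hy => hex ⟨y, hy⟩) _]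
      exact zero_le
  have hmR : ∀ m, Measurable ((runningSet φ m).indicator (1 : (ℕ → 𝒳) → ℝ≥0∞)) := fun m =>
    measurable_one.indicator (measurableSet_runningSet φ m)
  have hmA : Measurable ((atypicalSet μ a M).indicator (1 : (ℕ → 𝒳) → ℝ≥0∞)) :=
    measurable_one.indicator (measurableSet_atypicalSet μ a M)
  have hmT : Measurable fun ω => ∑' m, (runningSet φ m).indicator (1 : (ℕ → 𝒳) → ℝ≥0∞) ω :=
    Measurable.tsum hmR
  have hmW : Measurable fun ω => ∑ y, (outputSet φ y).indicator (fun _ => w y) ω :=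
    Finset.measurable_sum _ fun y _ => measurable_const.indicator (hmG y)
  rw [hleft]
  refine (lintegral_mono_ae hpt).trans ?_
  rw [lintegral_add_right _ hmW, lintegral_add_right _ (hmA.const_mul _),
    lintegral_add_right _ measurable_const, lintegral_const_mul _ hmT, lintegral_const_mul _ hmA,
    lintegral_tsum fun m => (hmR m).aemeasurable, lintegral_const, measure_univ, mul_one,
    lintegral_indicator_one (measurableSet_atypicalSet μ a M), ← hlogN]
  simp only [lintegral_indicator_one (measurableSet_runningSet φ _)]
  gcongr

end Lower

section Converse

lemma exists_measure_atypicalSet_le [MeasurableSpace 𝒳] (μ : Measure (ℕ → 𝒳)) {a : ℝ}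
    (htail : ∑' m : ℕ, μ {ω | cylP μ (pre ω m) ≤ (2 : ℝ) ^ (-((m : ℝ) * a))} ≠ ⊤)
    {ε : ℝ} (hε : 0 < ε) : ∃ M, μ (atypicalSet μ a M) ≤ ENNReal.ofReal ε := by
  obtain ⟨M, hM⟩ := ((ENNReal.tendsto_sum_nat_add _ htail).eventually_lt_const
    (ENNReal.ofReal_pos.2 hε)).exists
  exact ⟨M, (measure_iUnion_le _).trans hM.le⟩

variable [Fintype 𝒳] [MeasurableSpace 𝒳] [DiscreteMeasurableSpace 𝒳]
  [Fintype 𝒴] [MeasurableSpace 𝒴]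
  (μ : Measure (ℕ → 𝒳)) [IsProbabilityMeasure μ] (ν : Measure (ℕ → 𝒴)) [IsProbabilityMeasure ν]

/-- An upper-tail bound on the coin process bounds the target entropy rate by any average
achievable rate. -/
lemma entRate_le_of_limsup_le {φ : (n : ℕ) → List 𝒳 → Option (Fin n → 𝒴)}
    (hφ : ∀ n, Valid μ (fun y : Fin n → 𝒴 => cylP ν y) (φ n)) {L : ℝ} (hL : 0 ≤ L)
    (hlim : limsup (fun n : ℕ => (∑' m : ℕ, μ (runningSet (φ n) m)) / (n : ℝ≥0∞)) atTop
      ≤ ENNReal.ofReal L) {a : ℝ} (ha : 0 ≤ a)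
    (htail : ∑' m : ℕ, μ {ω | cylP μ (pre ω m) ≤ (2 : ℝ) ^ (-((m : ℝ) * a))} ≠ ⊤)
    {ε : ℝ} (hε : 0 < ε) :
    entRate ν ≤ a * (L + ε) + Real.logb 2 (Fintype.card 𝒴) * ε + ε := by
  obtain ⟨M, hM⟩ := exists_measure_atypicalSet_le μ htail hε
  have hc : (1 : ℝ) ≤ Fintype.card 𝒴 := by
    exact_mod_cast card_pos_of_isProbabilityMeasure ν
  have hlog : 0 ≤ Real.logb 2 (Fintype.card 𝒴) := Real.logb_nonneg one_lt_two hc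
  have hs := shortInfo_nonneg μ M
  have hlt : ∀ᶠ n : ℕ in atTop,
      (∑' m : ℕ, μ (runningSet (φ n) m)) / (n : ℝ≥0∞) < ENNReal.ofReal (L + ε) := by
    refine eventually_lt_of_limsup_lt (hlim.trans_lt ?_)
    exact (ENNReal.ofReal_lt_ofReal_iff (by linarith)).2 (by linarith)
  have hsn : ∀ᶠ n : ℕ in atTop, (shortInfo μ M + 2) / n < ε :=
    (tendsto_const_div_atTop_nhds_zero_nat _).eventually_lt_const hε
  rw [entRate_eq]
  refine limsup_le_of_le (isBoundedUnder_ge_blockEnt ν).isCoboundedUnder_le ?_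
  filter_upwards [hlt, hsn, eventually_gt_atTop 0] with n h1 h2 h3
  have hn : (0 : ℝ) < n := by exact_mod_cast h3
  have hT : ∑' m : ℕ, μ (runningSet (φ n) m) ≤ ENNReal.ofReal ((L + ε) * n) := by
    rw [ENNReal.ofReal_mul (by linarith), ENNReal.ofReal_natCast]
    exact (ENNReal.div_le_iff (by exact_mod_cast h3.ne') (ENNReal.natCast_ne_top n)).1 h1.le
  have hb : ENNReal.ofReal (blockEnt ν n) ≤ ENNReal.ofReal (a * ((L + ε) * n)
      + shortInfo μ M + n * Real.logb 2 (Fintype.card 𝒴) * ε + 2) := by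
    refine (blockEnt_le_of_valid μ ν (hφ n) ha M).trans ?_
    rw [ENNReal.ofReal_add (by positivity) two_pos.le,
      ENNReal.ofReal_add (by positivity) (by positivity),
      ENNReal.ofReal_add (by positivity) hs, ENNReal.ofReal_mul ha,
      ENNReal.ofReal_mul (q := ε) (by positivity)]
    gcongr
  rw [ENNReal.ofReal_le_ofReal_iff (by positivity)] at hb
  calc blockEnt ν n / n ≤ (a * ((L + ε) * n)
      + shortInfo μ M + n * Real.logb 2 (Fintype.card 𝒴) * ε + 2) / n := by gcongr
    _ = a * (L + ε) + Real.logb 2 (Fintype.card 𝒴) * ε + (shortInfo μ M + 2) / n := by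
        field_simp
        ring
    _ ≤ _ := by linarith

lemma ofReal_div_le_Lstar {H : ℝ} (hH : 0 < H)
    (htail : ∀ δ : ℝ, 0 < δ →
      ∑' m : ℕ, μ {ω | cylP μ (pre ω m) ≤ (2 : ℝ) ^ (-((m : ℝ) * (H + δ)))} ≠ ⊤) :
    ENNReal.ofReal (entRate ν / H) ≤ Lstar μ ν := by
  refine le_sInf fun L ⟨φ, hφ, hlim⟩ => ?_
  induction L with
  | top => exact le_top
  | coe L =>
    rw [← ENNReal.ofReal_coe_nnreal] at hlim ⊢
    refine ENNReal.ofReal_le_ofReal ((div_le_iff₀' hH).2 ?_)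
    have hcont : Tendsto (fun ε : ℝ => (H + ε) * (L + ε)
        + Real.logb 2 (Fintype.card 𝒴) * ε + ε) (nhdsWithin 0 (Set.Ioi 0))
        (nhds ((H + 0) * (L + 0) + Real.logb 2 (Fintype.card 𝒴) * 0 + 0)) :=
      ((by fun_prop : Continuous fun ε : ℝ => (H + ε) * (L + ε)
        + Real.logb 2 (Fintype.card 𝒴) * ε + ε).tendsto 0).mono_left nhdsWithin_le_nhds
    simp only [add_zero, mul_zero] at hcont
    refine ge_of_tendsto hcont ?_
    filter_upwards [self_mem_nhdsWithin] with ε hε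
    exact entRate_le_of_limsup_le μ ν hφ L.coe_nonneg hlim (by linarith [Set.mem_Ioi.1 hε])
      (htail ε hε) hε

end Converse

lemma Lint_le_ofReal_div [Fintype 𝒳] [LinearOrder 𝒳] [MeasurableSpace 𝒳]
    [DiscreteMeasurableSpace 𝒳] [Fintype 𝒴] [LinearOrder 𝒴] [MeasurableSpace 𝒴]
    [DiscreteMeasurableSpace 𝒴] (μ : Measure (ℕ → 𝒳)) [IsProbabilityMeasure μ]
    (ν : Measure (ℕ → 𝒴)) [IsProbabilityMeasure ν] {H : ℝ} (hH : 0 < H)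
    (htail : ∀ δ : ℝ, 0 < δ →
      ∑' m : ℕ, μ {ω | (2 : ℝ) ^ (-((m : ℝ) * (H - δ))) ≤ cylP μ (pre ω m)} ≠ ⊤) :
    Lint μ ν ≤ ENNReal.ofReal (entRate ν / H) := by
  have hcont : Tendsto (fun ε : ℝ => (entRate ν + ε) / (H - ε) + ε)
      (nhdsWithin 0 (Set.Ioi 0)) (nhds ((entRate ν + 0) / (H - 0) + 0)) := by
    refine Tendsto.mono_left (ContinuousAt.tendsto ?_) nhdsWithin_le_nhds
    have : H - 0 ≠ 0 := by simpa using hH.ne'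
    fun_prop (disch := assumption)
  simp only [add_zero, sub_zero] at hcont
  refine ge_of_tendsto (ENNReal.tendsto_ofReal hcont) ?_
  filter_upwards [Ioo_mem_nhdsGT hH] with ε hε
  exact sInf_le (limsup_intAvgT_le μ ν (sub_pos.2 hε.2) (htail ε hε.1) hε.1)

end RNG

open RNG
/-- **Corollary 4.** If the coin process `μ` satisfies both tail conditions and has
one-point spectrum `H̄(X) = H̲(X) = H(X) > 0`, then for any target process `ν` the interval
algorithm is asymptotically optimal for the average stopping time:
`L⋆_int(X,Y) = L⋆(X,Y) = H(Y)/H(X)`. -/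
theorem one_point_coin_spectrum_Lstar
    {𝒳 𝒴 : Type*} [Fintype 𝒳] [LinearOrder 𝒳] [MeasurableSpace 𝒳] [DiscreteMeasurableSpace 𝒳]
    [Fintype 𝒴] [LinearOrder 𝒴] [MeasurableSpace 𝒴] [DiscreteMeasurableSpace 𝒴]
    (μ : Measure (ℕ → 𝒳)) [IsProbabilityMeasure μ]
    (ν : Measure (ℕ → 𝒴)) [IsProbabilityMeasure ν]
    (hUT : UpperTail μ) (hLT : LowerTail μ)
    (hsup : specSup μ = entRate μ) (hinf : specInf μ = entRate μ)
    (hpos : 0 < entRate μ) :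
    Lint μ ν = ENNReal.ofReal (entRate ν / entRate μ)
    ∧ Lstar μ ν = ENNReal.ofReal (entRate ν / entRate μ) := by
  have hlow : ∀ δ : ℝ, 0 < δ → ∑' m : ℕ,
      μ {ω | (2 : ℝ) ^ (-((m : ℝ) * (entRate μ - δ))) ≤ cylP μ (pre ω m)} ≠ ⊤ := by
    intro δ hδ
    obtain ⟨K, m₀, h⟩ := hLT δ hδ
    rw [hinf] at h
    exact tsum_ne_top_of_toReal_le (fun m => measure_ne_top _ _) h
  have hupp : ∀ δ : ℝ, 0 < δ → ∑' m : ℕ,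
      μ {ω | cylP μ (pre ω m) ≤ (2 : ℝ) ^ (-((m : ℝ) * (entRate μ + δ)))} ≠ ⊤ := by
    intro δ hδ
    obtain ⟨K, m₀, h⟩ := hUT δ hδ
    rw [hsup] at h
    exact tsum_ne_top_of_toReal_le (fun m => measure_ne_top _ _) h
  have hfin : ∀ n, intAvgT μ ν n ≠ ⊤ := fun n =>
    ne_top_of_le_ne_top (ENNReal.add_ne_top.2 ⟨hlow _ (half_pos hpos), ENNReal.ofReal_ne_top⟩)
      (intAvgT_le μ ν (by linarith) n)
  have h1 := Lint_le_ofReal_div μ ν hpos hlow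
  have h2 := Lstar_le_Lint (μ := μ) (ν := ν) hfin
  have h3 := ofReal_div_le_Lstar μ ν hpos hupp
  exact ⟨le_antisymm h1 (h3.trans h2), le_antisymm (h2.trans h1) h3⟩
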